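/- arXiv:1605.08943 — 6 statements merged into one kernel-verified Lean document; each statement's English description precedes it below -/
import Mathlib

section
/- Let V be a type, G a simple graph on V, and S a set of vertices of G. Suppose r assigns to each vertex v a nonempty finite set r(v) of vertices, all belonging to S, such that (i) r(s) = {s} for every s ∈ S, and (ii) whenever vertices u and v are equal or adjacent in G, every x ∈ r(u) and every y ∈ r(v) are equal or adjacent in G. Then for all s, t ∈ S with s and t reachable from one another in G, there exists a walk in G from s to t whose length equals the graph distance between s and t and all of whose vertices lie in S. In particular, any two vertices of S are joined by a geodesic of G lying entirely in S. -/
/-- A walk in `G` is tracked by the values of a 1-Lipschitz set-valued map `r`: if `r` takes a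
single value `t` at the end of the walk, every value at its start is joined to `t` by a walk
through values of `r` that is no longer than the original one. -/
theorem SimpleGraph.Walk.exists_walk_length_le_of_setValued_lipschitz {V : Type*}
    {G : SimpleGraph V} {S : Set V} {r : V → Finset V}
    (hne : ∀ v, (r v).Nonempty)
    (hsub : ∀ v, ∀ x ∈ r v, x ∈ S)
    (hlip : ∀ u v : V, G.Adj u v → ∀ x ∈ r u, ∀ y ∈ r v, x = y ∨ G.Adj x y)
    {u v t : V} (w : G.Walk u v) (ht : r v = {t}) :
    ∀ x ∈ r u, ∃ p : G.Walk x t, p.length ≤ w.length ∧ ∀ z ∈ p.support, z ∈ S := by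
  induction w with
  | nil =>
    intro x hx
    have hxS := hsub _ x hx
    rw [ht, Finset.mem_singleton] at hx
    subst hx
    exact ⟨.nil, le_rfl, by simpa using hxS⟩
  | cons h w ih =>
    intro x hx
    obtain ⟨y, hy⟩ := hne _
    obtain ⟨p, hp, hpS⟩ := ih ht y hy
    rcases hlip _ _ h x hx y hy with rfl | hadj
    · exact ⟨p, hp.trans (Nat.le_succ _), hpS⟩
    · exact ⟨.cons hadj p, Nat.succ_le_succ hp, by simpa using ⟨hsub _ x hx, hpS⟩⟩

/-- A coarse 1-Lipschitz set-valued retraction of a graph onto a vertex set `S`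
forces `S` to be geodesically connected: any two reachable vertices of `S` are
joined by a geodesic (a walk of length equal to the graph distance) all of whose
vertices lie in `S`. -/
theorem geodesically_connected_of_retraction {V : Type*} (G : SimpleGraph V)
    (S : Set V) (r : V → Finset V)
    (hne : ∀ v, (r v).Nonempty)
    (hsub : ∀ v, ∀ x ∈ r v, x ∈ S)
    (hid : ∀ s ∈ S, r s = {s})
    (hlip : ∀ u v : V, (u = v ∨ G.Adj u v) →
      ∀ x ∈ r u, ∀ y ∈ r v, x = y ∨ G.Adj x y) :
    ∀ s ∈ S, ∀ t ∈ S, G.Reachable s t →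
      ∃ p : G.Walk s t, p.length = G.dist s t ∧ ∀ v ∈ p.support, v ∈ S := by
  intro s hs t ht hst
  obtain ⟨w, hw⟩ := hst.exists_walk_length_eq_dist
  obtain ⟨p, hp, hpS⟩ := w.exists_walk_length_le_of_setValued_lipschitz hne hsub
    (fun u v h => hlip u v (.inr h)) (hid t ht) s (by simp [hid s hs])
  exact ⟨p, le_antisymm (hp.trans hw.le) (SimpleGraph.dist_le p), hpS⟩
end

section
/- Let a₂ ≤ a₁ ≤ b₁ ≤ b₂ and c₁ ≤ c₂ ≤ d₂ ≤ d₁ be real numbers. Let p = (p₁, c₁) and q = (q₁, d₁) be points of ℝ × ℝ with p₁, q₁ ∈ [a₁, b₁], and let r = (a₂, r₂) and s = (b₂, s₂) be points of ℝ × ℝ with r₂, s₂ ∈ [c₂, d₂]. Then the closed segment from p to q and the closed segment from r to s have nonempty intersection. -/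
/-- If two axis-parallel rectangles meet crosswise (the first crossing the second
from top to bottom), then any segment joining the bottom edge of the first to its
top edge meets any segment joining the left edge of the second to its right edge. -/
theorem crosswise_segments_intersect
    (a₁ a₂ b₁ b₂ c₁ c₂ d₁ d₂ : ℝ)
    (hA : a₂ ≤ a₁) (hAB : a₁ ≤ b₁) (hB : b₁ ≤ b₂)
    (hC : c₁ ≤ c₂) (hCD : c₂ ≤ d₂) (hD : d₂ ≤ d₁)
    (p₁ q₁ r₂ s₂ : ℝ)
    (hp : p₁ ∈ Set.Icc a₁ b₁) (hq : q₁ ∈ Set.Icc a₁ b₁)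
    (hr : r₂ ∈ Set.Icc c₂ d₂) (hs : s₂ ∈ Set.Icc c₂ d₂) :
    (segment ℝ ((p₁, c₁) : ℝ × ℝ) ((q₁, d₁) : ℝ × ℝ) ∩
      segment ℝ ((a₂, r₂) : ℝ × ℝ) ((b₂, s₂) : ℝ × ℝ)).Nonempty := by
  obtain ⟨hp1, hp2⟩ := hp
  obtain ⟨hq1, hq2⟩ := hq
  obtain ⟨hr1, hr2⟩ := hr
  obtain ⟨hs1, hs2⟩ := hs
  rcases (hA.trans (hAB.trans hB)).eq_or_lt with h | h
  · obtain ⟨t, u, ht, hu, htu, e⟩ : r₂ ∈ segment ℝ c₁ d₁ := by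
      rw [segment_eq_Icc (by linarith)]
      constructor <;> linarith
    refine ⟨(a₂, r₂), ⟨t, u, ht, hu, htu, Prod.ext ?_ e⟩, left_mem_segment ℝ _ _⟩
    have hpa : p₁ = a₂ := by linarith
    have hqa : q₁ = a₂ := by linarith
    simp only [Prod.smul_mk, Prod.mk_add_mk, smul_eq_mul, hpa, hqa]
    rw [← add_mul, htu, one_mul]
  · have hbot : (b₂ - p₁) * (c₁ - r₂) + (p₁ - a₂) * (c₁ - s₂) ≤ 0 :=
      add_nonpos (mul_nonpos_of_nonneg_of_nonpos (by linarith) (by linarith))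
        (mul_nonpos_of_nonneg_of_nonpos (by linarith) (by linarith))
    have htop : 0 ≤ (b₂ - q₁) * (d₁ - r₂) + (q₁ - a₂) * (d₁ - s₂) :=
      add_nonneg (mul_nonneg (by linarith) (by linarith))
        (mul_nonneg (by linarith) (by linarith))
    -- The height above the line through `r` and `s` changes sign along the first segment.
    obtain ⟨t, u, ht, hu, htu, e⟩ : (0 : ℝ) ∈ segment ℝ
        ((b₂ - p₁) * (c₁ - r₂) + (p₁ - a₂) * (c₁ - s₂))
        ((b₂ - q₁) * (d₁ - r₂) + (q₁ - a₂) * (d₁ - s₂)) := by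
      rw [segment_eq_Icc (hbot.trans htop)]
      exact ⟨hbot, htop⟩
    obtain rfl : t = 1 - u := by linarith
    simp only [smul_eq_mul] at e
    obtain ⟨v, w, hv, hw, hvw, hx⟩ : (1 - u) * p₁ + u * q₁ ∈ segment ℝ a₂ b₂ := by
      rw [segment_eq_Icc h.le]
      constructor <;> nlinarith
    obtain rfl : v = 1 - w := by linarith
    simp only [smul_eq_mul] at hx
    refine ⟨_, ⟨1 - u, u, ht, hu, htu, rfl⟩, ⟨1 - w, w, hv, hw, hvw, Prod.ext hx ?_⟩⟩
    simp only [Prod.smul_mk, Prod.mk_add_mk, smul_eq_mul]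
    apply mul_left_cancel₀ (sub_pos.mpr h).ne'
    linear_combination (s₂ - r₂) * hx - e
end

section
/- Let a₂ < a₁ ≤ b₁ < b₂ and c₁ < c₂ ≤ d₂ < d₁ be real numbers. Let p = (p₁, c₁) and q = (q₁, d₁) be points of ℝ × ℝ with p₁, q₁ ∈ [a₁, b₁], and let r = (a₂, r₂) and s = (b₂, s₂) be points of ℝ × ℝ with r₂, s₂ ∈ [c₂, d₂]. Then there exists a point z lying both on the closed segment from p to q and on the closed segment from r to s, with z ≠ p, z ≠ q, z ≠ r, and z ≠ s; that is, the two segments intersect at a point interior to both. -/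
/-- If two axis-parallel rectangles meet properly crosswise, then any two of their
diagonals intersect at a point interior to both segments. -/
theorem properly_crosswise_segments_intersect_interior
    (a₁ a₂ b₁ b₂ c₁ c₂ d₁ d₂ : ℝ)
    (hA : a₂ < a₁) (hAB : a₁ ≤ b₁) (hB : b₁ < b₂)
    (hC : c₁ < c₂) (hCD : c₂ ≤ d₂) (hD : d₂ < d₁)
    (p₁ q₁ r₂ s₂ : ℝ)
    (hp : p₁ ∈ Set.Icc a₁ b₁) (hq : q₁ ∈ Set.Icc a₁ b₁)
    (hr : r₂ ∈ Set.Icc c₂ d₂) (hs : s₂ ∈ Set.Icc c₂ d₂) :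
    ∃ z : ℝ × ℝ,
      z ∈ segment ℝ ((p₁, c₁) : ℝ × ℝ) ((q₁, d₁) : ℝ × ℝ) ∧
      z ∈ segment ℝ ((a₂, r₂) : ℝ × ℝ) ((b₂, s₂) : ℝ × ℝ) ∧
      z ≠ (p₁, c₁) ∧ z ≠ (q₁, d₁) ∧ z ≠ (a₂, r₂) ∧ z ≠ (b₂, s₂) := by
  obtain ⟨hp, hp'⟩ := hp
  obtain ⟨hq, hq'⟩ := hq
  obtain ⟨hr, hr'⟩ := hr
  obtain ⟨hs, hs'⟩ := hs
  have hL : 0 < b₂ - a₂ := by linarith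
  -- The signed areas separating the endpoints of the first segment from the second segment.
  obtain ⟨u, hu⟩ : ∃ u, u = (p₁ - a₂) * (s₂ - c₁) + (b₂ - p₁) * (r₂ - c₁) := ⟨_, rfl⟩
  obtain ⟨v, hv⟩ : ∃ v, v = (q₁ - a₂) * (d₁ - s₂) + (b₂ - q₁) * (d₁ - r₂) := ⟨_, rfl⟩
  have hu₀ : 0 < u := by
    rw [hu]
    exact add_pos (mul_pos (by linarith) (by linarith)) (mul_pos (by linarith) (by linarith))
  have hv₀ : 0 < v := by
    rw [hv]
    exact add_pos (mul_pos (by linarith) (by linarith)) (mul_pos (by linarith) (by linarith))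
  obtain ⟨t, ht⟩ : ∃ t, t = u / (u + v) := ⟨_, rfl⟩
  have ht₀ : 0 < t := ht ▸ by positivity
  have ht₁ : t < 1 := by
    rw [ht, div_lt_one (by positivity)]
    linarith
  have htuv : t * (u + v) = u := by
    rw [ht]
    exact div_mul_cancel₀ u (by positivity)
  obtain ⟨x, hx⟩ : ∃ x, x = (1 - t) * p₁ + t * q₁ := ⟨_, rfl⟩
  obtain ⟨y, hy⟩ : ∃ y, y = (1 - t) * c₁ + t * d₁ := ⟨_, rfl⟩
  have hax : a₂ < x := by nlinarith
  have hxb : x < b₂ := by nlinarith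
  have hcy : c₁ < y := by nlinarith
  have hyd : y < d₁ := by nlinarith
  have hline : (b₂ - x) * r₂ + (x - a₂) * s₂ = (b₂ - a₂) * y := by
    rw [hu, hv] at htuv
    rw [hx, hy]
    linear_combination -htuv
  refine ⟨(x, y), ⟨1 - t, t, by linarith, ht₀.le, by ring, ?_⟩,
    ⟨(b₂ - x) / (b₂ - a₂), (x - a₂) / (b₂ - a₂), div_nonneg (by linarith) hL.le,
      div_nonneg (by linarith) hL.le, ?_, ?_⟩, ?_, ?_, ?_, ?_⟩
  · simp [hx, hy]
  · field_simp
    ring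
  · ext
    · simp only [Prod.smul_mk, Prod.mk_add_mk, smul_eq_mul]
      field_simp
      ring
    · simp only [Prod.smul_mk, Prod.mk_add_mk, smul_eq_mul]
      field_simp
      linarith
  · exact fun h => hcy.ne' (congrArg Prod.snd h)
  · exact fun h => hyd.ne (congrArg Prod.snd h)
  · exact fun h => hax.ne' (congrArg Prod.fst h)
  · exact fun h => hxb.ne (congrArg Prod.fst h)
end

section
/- Let m < 0 and c be real numbers and define ℓ(x) = m·x + c. For real numbers u ≤ v, let T(u,v) denote the convex hull in ℝ × ℝ of the three points (u, ℓ(u)), (v, ℓ(v)), and (u, ℓ(v)) — the closed right triangle with a vertical leg and a horizontal leg whose hypotenuse is the segment of the line y = ℓ(x) over [u,v]. Then for all real numbers u ≤ u' ≤ v ≤ v', one has T(u,v) ∩ T(u',v') = T(u',v). -/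
/-- A right triangle with axis-parallel legs, lying below a hypotenuse on the line `y = m x + c`
of negative slope, is cut out by three linear inequalities. -/
theorem convexHull_right_triangle_eq {m c u v : ℝ} (hm : m < 0) (huv : u ≤ v) :
    convexHull ℝ ({(u, m * u + c), (v, m * v + c), (u, m * v + c)} : Set (ℝ × ℝ)) =
      {p | u ≤ p.1 ∧ m * v + c ≤ p.2 ∧ p.2 ≤ m * p.1 + c} := by
  apply Set.Subset.antisymm
  · apply convexHull_min
    · rintro p (rfl | rfl | rfl) <;> simp only [Set.mem_ofPred_eq] <;>
        refine ⟨?_, ?_, ?_⟩ <;> nlinarith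
    · rintro ⟨x, y⟩ ⟨hx, hy, hxy⟩ ⟨x', y'⟩ ⟨hx', hy', hxy'⟩ a b ha hb hab
      obtain rfl : b = 1 - a := by linarith
      dsimp only at hx hy hxy hx' hy' hxy'
      refine ⟨?_, ?_, ?_⟩ <;> simp only [Prod.smul_mk, Prod.mk_add_mk, smul_eq_mul] <;>
        nlinarith
  · rintro ⟨x, y⟩ ⟨hx, hy, hxy⟩
    dsimp only at hx hy hxy
    rcases huv.eq_or_lt with rfl | huv
    · obtain rfl : x = u := by nlinarith
      obtain rfl : y = m * x + c := le_antisymm hxy hy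
      exact subset_convexHull ℝ _ (by simp)
    · have hd : 0 < v - u := sub_pos.2 huv
      have hmd : 0 < -m * (v - u) := mul_pos (neg_pos.2 hm) hd
      set a := (y - (m * v + c)) / (-m * (v - u))
      set b := (x - u) / (v - u)
      have ha' : a * (-m * (v - u)) = y - (m * v + c) := div_mul_cancel₀ _ hmd.ne'
      have hb' : b * (v - u) = x - u := div_mul_cancel₀ _ hd.ne'
      have ha0 : 0 ≤ a := div_nonneg (by linarith) hmd.le
      have hb0 : 0 ≤ b := div_nonneg (by linarith) hd.le
      have hab : 0 ≤ 1 - a - b := by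
        refine nonneg_of_mul_nonneg_left (b := -m * (v - u)) ?_ hmd
        linear_combination hxy + ha' - m * hb'
      have key := (convex_convexHull ℝ
        ({(u, m * u + c), (v, m * v + c), (u, m * v + c)} : Set (ℝ × ℝ))).sum_mem
        (t := Finset.univ) (w := ![a, b, 1 - a - b])
        (z := ![(u, m * u + c), (v, m * v + c), (u, m * v + c)])
        (by intro i _; fin_cases i; exacts [ha0, hb0, hab])
        (by simp [Fin.sum_univ_three])
        (by intro i _; apply subset_convexHull; fin_cases i <;> simp)
      convert key using 1
      simp only [Fin.sum_univ_three, Matrix.cons_val, Prod.smul_mk, Prod.mk_add_mk, smul_eq_mul,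
        Prod.mk.injEq]
      constructor
      · linear_combination -hb'
      · linear_combination -ha'

/-- Two right triangles with axis-parallel legs attached along their hypotenuses
to the same negatively sloped line, on the same side of the line, intersect in
exactly the right triangle spanned by the common subarc of their hypotenuses. -/
theorem triangle_hulls_intersection (m c : ℝ) (hm : m < 0)
    (ℓ : ℝ → ℝ) (hℓ : ∀ x, ℓ x = m * x + c)
    (T : ℝ → ℝ → Set (ℝ × ℝ))
    (hT : ∀ u v : ℝ, T u v =
      convexHull ℝ ({(u, ℓ u), (v, ℓ v), (u, ℓ v)} : Set (ℝ × ℝ)))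
    (u u' v v' : ℝ) (h1 : u ≤ u') (h2 : u' ≤ v) (h3 : v ≤ v') :
    T u v ∩ T u' v' = T u' v := by
  simp only [hT, hℓ]
  rw [convexHull_right_triangle_eq hm (h1.trans h2),
    convexHull_right_triangle_eq hm (h2.trans h3), convexHull_right_triangle_eq hm h2]
  ext ⟨x, y⟩
  have hv : m * v' ≤ m * v := mul_le_mul_of_nonpos_left h3 hm.le
  constructor
  · rintro ⟨⟨-, hy, hxy⟩, hx, -, -⟩
    exact ⟨hx, hy, hxy⟩
  · rintro ⟨hx, hy, hxy⟩
    exact ⟨⟨h1.trans hx, hy, hxy⟩, hx, by linarith, hxy⟩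
end

section
/- Let X be a metric space, let m ≥ 1 and N be natural numbers, and let T₀, T₁, …, T_N be finite subsets of X such that: (i) each Tᵢ has cardinality at least m + 1; (ii) each Tᵢ has diameter at most 1, i.e. dist(x,y) ≤ 1 for all x, y ∈ Tᵢ; and (iii) for each i < N there exists an element e such that Tᵢ \ {e} ⊆ Tᵢ₊₁ (consecutive sets differ by exchanging at most one element). Then there exist a ∈ T₀ and b ∈ T_N with dist(a, b) ≤ N/m + 1 (real division). -/
/-- Along a sequence of finite sets in which every step loses at most one element,
`k` steps lose at most `k` elements. -/
theorem card_sdiff_le_of_exchange_sequence {X : Type*} [DecidableEq X] {N : ℕ}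
    {T : ℕ → Finset X} (hexch : ∀ i < N, ∃ e : X, T i \ {e} ⊆ T (i + 1)) (i k : ℕ)
    (hik : i + k ≤ N) : (T i \ T (i + k)).card ≤ k := by
  induction k with
  | zero => simp
  | succ k ih =>
    obtain ⟨e, he⟩ := hexch (i + k) (by omega)
    have hsub : T i \ T (i + (k + 1)) ⊆ insert e (T i \ T (i + k)) := by
      intro x hx
      rw [Finset.mem_sdiff] at hx
      by_cases hxe : x = e
      · simp [hxe]
      · refine Finset.mem_insert_of_mem (Finset.mem_sdiff.2 ⟨hx.1, fun hxk => hx.2 ?_⟩)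
        exact he (by simp [hxk, hxe])
    exact (Finset.card_le_card hsub).trans
      ((Finset.card_insert_le _ _).trans (Nat.succ_le_succ (ih (by omega))))

/-- Two terms at most `m` steps apart in an exchange sequence have a common element,
provided the first has more than `m` elements. -/
theorem exists_mem_mem_of_exchange_sequence {X : Type*} [DecidableEq X] {m N : ℕ}
    {T : ℕ → Finset X} (hexch : ∀ i < N, ∃ e : X, T i \ {e} ⊆ T (i + 1)) {i k : ℕ}
    (hcard : m + 1 ≤ (T i).card) (hk : k ≤ m) (hik : i + k ≤ N) :
    ∃ c ∈ T i, c ∈ T (i + k) := by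
  by_contra! h
  have hle := card_sdiff_le_of_exchange_sequence hexch i k hik
  rw [Finset.sdiff_eq_self_of_disjoint (Finset.disjoint_left.2 h)] at hle
  omega

/-- Terms `k` steps apart in an exchange sequence contain points within distance
`k / m` of each other. -/
theorem exists_dist_le_div_of_exchange_sequence {X : Type*} [PseudoMetricSpace X]
    [DecidableEq X] {m N : ℕ} (hm : 1 ≤ m) {T : ℕ → Finset X}
    (hcard : ∀ i ≤ N, m + 1 ≤ (T i).card)
    (hdiam : ∀ i ≤ N, ∀ x ∈ T i, ∀ y ∈ T i, dist x y ≤ 1)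
    (hexch : ∀ i < N, ∃ e : X, T i \ {e} ⊆ T (i + 1)) (i k : ℕ) (hik : i + k ≤ N) :
    ∃ a ∈ T i, ∃ b ∈ T (i + k), dist a b ≤ (k : ℝ) / (m : ℝ) := by
  induction k using Nat.strong_induction_on generalizing i with
  | _ k ih =>
    rcases le_total k m with hk | hk
    · obtain ⟨c, hc, hc'⟩ :=
        exists_mem_mem_of_exchange_sequence hexch (hcard i (by omega)) hk hik
      exact ⟨c, hc, c, hc', by rw [dist_self]; positivity⟩
    · obtain ⟨c, hc, hc'⟩ :=
        exists_mem_mem_of_exchange_sequence hexch (hcard i (by omega)) le_rfl (by omega)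
      obtain ⟨a, ha, b, hb, hab⟩ := ih (k - m) (by omega) (i + m) (by omega)
      rw [show i + m + (k - m) = i + k by omega] at hb
      refine ⟨c, hc, b, hb, ?_⟩
      have hm0 : (m : ℝ) ≠ 0 := by positivity
      rw [Nat.cast_sub hk, sub_div, div_self hm0] at hab
      linarith [dist_triangle c a b, hdiam (i + m) (by omega) c hc' a ha]

/-- Counting lemma: if finite sets `T 0, …, T N` in a metric space each have at
least `m + 1` elements and diameter at most `1`, and consecutive sets differ by
exchanging at most one element, then some point of `T 0` and some point of `T N`
lie within distance `N / m + 1` of each other. -/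
theorem exists_close_points_of_exchange_sequence
    {X : Type*} [MetricSpace X] [DecidableEq X] (m N : ℕ) (hm : 1 ≤ m)
    (T : ℕ → Finset X)
    (hcard : ∀ i ≤ N, m + 1 ≤ (T i).card)
    (hdiam : ∀ i ≤ N, ∀ x ∈ T i, ∀ y ∈ T i, dist x y ≤ 1)
    (hexch : ∀ i < N, ∃ e : X, T i \ {e} ⊆ T (i + 1)) :
    ∃ a ∈ T 0, ∃ b ∈ T N, dist a b ≤ (N : ℝ) / (m : ℝ) + 1 := by
  obtain ⟨a, ha, b, hb, hab⟩ :=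
    exists_dist_le_div_of_exchange_sequence hm hcard hdiam hexch 0 N (by omega)
  rw [zero_add] at hb
  exact ⟨a, ha, b, hb, by linarith⟩
end

section
/- Let X be a metric space, let p, q ∈ X, let c be a real number with c > 1, and let x₀, x₁, …, x_N be a finite sequence of points of X such that dist(xᵢ, xᵢ₊₁) ≤ 1 for all 0 ≤ i < N, dist(x₀, p) ≤ 1, dist(x_N, q) ≤ 1, and dist(p, q) > 2c + 2. Then there exist indices 0 ≤ a ≤ b ≤ N such that dist(xᵢ, p) ≥ c and dist(xᵢ, q) ≥ c for every i with a ≤ i ≤ b, and dist(x_a, x_b) ≥ dist(p, q) − 2c − 2. -/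
/-- Abstract content of the isolated-pocket lemma: along a chain of points with
unit steps going from near `p` to near `q`, with `dist p q > 2c + 2`, there is a
sub-chain all of whose points stay at distance at least `c` from both `p` and `q`,
whose endpoints are at distance at least `dist p q - 2c - 2` from each other. -/
theorem exists_isolated_subchain {X : Type*} [MetricSpace X]
    (p q : X) (c : ℝ) (hc : 1 < c) (N : ℕ) (x : ℕ → X)
    (hstep : ∀ i < N, dist (x i) (x (i + 1)) ≤ 1)
    (hp : dist (x 0) p ≤ 1) (hq : dist (x N) q ≤ 1)
    (hpq : 2 * c + 2 < dist p q) :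
    ∃ a b : ℕ, a ≤ b ∧ b ≤ N ∧
      (∀ i, a ≤ i → i ≤ b → c ≤ dist (x i) p ∧ c ≤ dist (x i) q) ∧
      dist p q - 2 * c - 2 ≤ dist (x a) (x b) := by
  classical
  have hN : ∃ i, dist (x i) q < c := ⟨N, by linarith⟩
  obtain ⟨m, hm, hmin⟩ : ∃ m, dist (x m) q < c ∧ ∀ i < m, c ≤ dist (x i) q :=
    ⟨Nat.find hN, Nat.find_spec hN, fun i hi => not_lt.mp (Nat.find_min hN hi)⟩
  have hmN : m ≤ N := by
    by_contra! h
    linarith [hmin N h]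
  obtain ⟨k, hkm, hk, hmax⟩ :
      ∃ k ≤ m, dist (x k) p < c ∧ ∀ i, k < i → i ≤ m → c ≤ dist (x i) p :=
    ⟨Nat.findGreatest (fun i => dist (x i) p < c) m, Nat.findGreatest_le m,
      Nat.findGreatest_spec (P := fun i => dist (x i) p < c) (Nat.zero_le m) (by linarith),
      fun i hi him => not_lt.mp (Nat.findGreatest_is_greatest hi him)⟩
  have htri (i j : ℕ) : dist p q ≤ dist (x i) p + dist (x i) (x j) + dist (x j) q := by
    simpa only [dist_comm p (x i)] using dist_triangle4 p (x i) (x j) q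
  have hkm_ne : k ≠ m := by
    rintro rfl
    linarith [htri k k, dist_self (x k)]
  have hkm_succ : k + 1 ≠ m := by
    rintro rfl
    linarith [htri k (k + 1), hstep k (by omega)]
  obtain ⟨b, rfl⟩ : ∃ b, m = b + 1 := ⟨m - 1, by omega⟩
  refine ⟨k + 1, b, by omega, by omega,
    fun i hi hib => ⟨hmax i (by omega) (by omega), hmin i (by omega)⟩, ?_⟩
  linarith [htri (k + 1) b, hstep k (by omega), hstep b (by omega),
    dist_triangle_left (x (k + 1)) p (x k), dist_triangle (x b) (x (b + 1)) q]
end
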